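/- Let μ be quasi-infinitely divisible with characteristic triplet (a, ν, γ)_c where c(x) = x·1_{|x|≤1}, and let h: ℝ → [0,∞) be submultiplicative. Then the following are equivalent: (i) ∫_ℝ h dμ < ∞ and ∫_{|x|>1} h dν⁻ < ∞; (ii) ∫_{|x|>1} h dν⁺ < ∞. In particular, finiteness of the h-moment of ν⁺ restricted to {|x|>1} implies finiteness of the h-moment of ν⁻ restricted to {|x|>1}. -/

import Mathlib

open MeasureTheory Complex Filter

noncomputable section

/-- Characteristic function of a measure on ℝ. -/
def charFn (μ : Measure ℝ) (z : ℝ) : ℂ := ∫ x, Complex.exp (Complex.I * z * x) ∂μ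

/-- A representation function: bounded, Borel measurable, with (c x - x)/x² → 0 as x → 0. -/
def IsRepFn (c : ℝ → ℝ) : Prop :=
  Measurable c ∧ (∃ M : ℝ, ∀ x, |c x| ≤ M) ∧
    Tendsto (fun x => (c x - x) / x ^ 2) (nhdsWithin 0 {(0:ℝ)}ᶜ) (nhds 0)

/-- The kernel g_c(x,z). -/
def gKer (c : ℝ → ℝ) (x z : ℝ) : ℂ :=
  if x = 0 then -(z:ℂ)^2 / 2
  else (Complex.exp (Complex.I * z * x) - 1 - Complex.I * z * c x) / ((min 1 (x^2) : ℝ) : ℂ)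

/-- Quasi-infinitely divisible w.r.t. c: the characteristic function has a
Lévy–Khintchine type representation with a finite signed measure ζ = ζp - ζm
(given by its Jordan decomposition). -/
def IsQID (c : ℝ → ℝ) (μ : Measure ℝ) : Prop :=
  ∃ γ : ℝ, ∃ ζp ζm : Measure ℝ, IsFiniteMeasure ζp ∧ IsFiniteMeasure ζm ∧
    Measure.MutuallySingular ζp ζm ∧
    ∀ z : ℝ, charFn μ z =
      Complex.exp (Complex.I * γ * z + (∫ x, gKer c x z ∂ζp) - ∫ x, gKer c x z ∂ζm)

/-- Infinitely divisible w.r.t. c: as above with a (positive) finite measure ζ. -/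
def IsID (c : ℝ → ℝ) (μ : Measure ℝ) : Prop :=
  ∃ γ : ℝ, ∃ ζ : Measure ℝ, IsFiniteMeasure ζ ∧
    ∀ z : ℝ, charFn μ z = Complex.exp (Complex.I * γ * z + ∫ x, gKer c x z ∂ζ)

/-- The Lévy–Khintchine integral ∫ (e^{izx} - 1 - izc(x)) dν. -/
def lkInt (c : ℝ → ℝ) (ν : Measure ℝ) (z : ℝ) : ℂ :=
  ∫ x, (Complex.exp (Complex.I * z * x) - 1 - Complex.I * z * c x) ∂ν

/-- μ has characteristic triplet (a, ν, γ) w.r.t. c, where the quasi-Lévy measure ν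
is given by its Jordan decomposition ν = νp - νm. -/
def HasTriplet (c : ℝ → ℝ) (μ : Measure ℝ) (a : ℝ) (νp νm : Measure ℝ) (γ : ℝ) : Prop :=
  Measure.MutuallySingular νp νm ∧ νp {0} = 0 ∧ νm {0} = 0 ∧
  (∫⁻ x, ENNReal.ofReal (min 1 (x^2)) ∂(νp + νm)) < ⊤ ∧
  ∀ z : ℝ, charFn μ z =
    Complex.exp (Complex.I * γ * z - a * z^2 / 2 + lkInt c νp z - lkInt c νm z)

open scoped ENNReal Topology
section Submultiplicative

variable {h : ℝ → ℝ} {B : ℝ}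

/-- A measurable submultiplicative function is bounded near the origin. -/
lemma exists_le_near_zero_of_submultiplicative (hmeas : Measurable h) (hnn : ∀ x, 0 ≤ h x)
    (hB : 0 < B) (hsub : ∀ x y : ℝ, h (x + y) ≤ B * h x * h y) :
    ∃ K δ : ℝ, 0 < δ ∧ ∀ x, |x| < δ → h x ≤ K := by
  let E : ℕ → Set ℝ := fun n => {x | h x ≤ n ∧ h (-x) ≤ n}
  have hE : ∀ n, MeasurableSet (E n) := fun n =>
    (measurableSet_le hmeas measurable_const).inter
      (measurableSet_le (hmeas.comp measurable_neg) measurable_const)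
  have hU : ⋃ n, E n = Set.univ := by
    refine Set.eq_univ_of_forall fun x => Set.mem_iUnion.2 ?_
    obtain ⟨n, hn⟩ := exists_nat_ge (max (h x) (h (-x)))
    exact ⟨n, (le_max_left _ _).trans hn, (le_max_right _ _).trans hn⟩
  obtain ⟨n, hn⟩ : ∃ n, 0 < volume (E n) := by
    by_contra! hcon
    have h0 : volume (⋃ n, E n) = 0 :=
      measure_iUnion_null fun n => le_antisymm (hcon n) bot_le
    rw [hU] at h0
    simp at h0
  obtain ⟨δ, hδ, hball⟩ := Metric.mem_nhds_iff.1
    (Measure.sub_mem_nhds_zero_of_addHaar_pos volume (E n) (hE n) hn)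
  refine ⟨B * n * n, δ, hδ, fun x hx => ?_⟩
  obtain ⟨u, hu, v, hv, rfl⟩ := hball (show x ∈ Metric.ball 0 δ by simpa using hx)
  simp only [sub_eq_add_neg]
  refine (hsub u (-v)).trans ?_
  have h1 := hu.1
  have h2 := hv.2
  have h3 := hnn u
  have h4 := hnn (-v)
  gcongr

/-- A measurable submultiplicative function grows at most exponentially. -/
lemma exists_le_exp_of_submultiplicative (hmeas : Measurable h) (hnn : ∀ x, 0 ≤ h x)
    (hB : 0 < B) (hsub : ∀ x y : ℝ, h (x + y) ≤ B * h x * h y) :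
    ∃ C c : ℝ, 0 ≤ C ∧ ∀ x, h x ≤ C * Real.exp (c * |x|) := by
  obtain ⟨K₀, δ, hδ, hK₀⟩ := exists_le_near_zero_of_submultiplicative hmeas hnn hB hsub
  obtain ⟨K, hK, hBK, hK0⟩ : ∃ K, (∀ x, |x| < δ → h x ≤ K) ∧ 1 ≤ B * K ∧ 0 ≤ K := by
    refine ⟨max K₀ B⁻¹, fun x hx => (hK₀ x hx).trans (le_max_left _ _), ?_,
      (inv_pos.2 hB).le.trans (le_max_right _ _)⟩
    calc (1 : ℝ) = B * B⁻¹ := (mul_inv_cancel₀ hB.ne').symm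
      _ ≤ _ := by gcongr; exact le_max_right _ _
  have hpow : ∀ t, |t| < δ → ∀ m : ℕ, h (m * t) ≤ K * (B * K) ^ m := by
    intro t ht m
    induction m with
    | zero => simpa using hK 0 (by simpa using hδ)
    | succ m ih =>
      have h1 := hK t ht
      have h2 := hnn t
      calc h ((m + 1 : ℕ) * t) = h (m * t + t) := by push_cast; ring_nf
        _ ≤ B * h (m * t) * h t := hsub _ _
        _ ≤ B * (K * (B * K) ^ m) * K := by gcongr
        _ = _ := by ring
  refine ⟨K * Real.exp (2 * Real.log (B * K)), Real.log (B * K) / δ, by positivity, fun x => ?_⟩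
  let m : ℕ := ⌈|x| / δ⌉₊ + 1
  have hm : |x| / δ < m := by
    have := Nat.le_ceil (|x| / δ)
    push_cast [m]
    linarith
  have hm' : (m : ℝ) ≤ |x| / δ + 2 := by
    have := (Nat.ceil_lt_add_one (show 0 ≤ |x| / δ by positivity)).le
    push_cast [m]
    linarith
  have hm0 : (0 : ℝ) < m := by positivity
  have ht : |x / m| < δ := by
    rw [abs_div, abs_of_pos hm0, div_lt_iff₀ hm0, mul_comm]
    exact (div_lt_iff₀ hδ).1 hm
  have hlog : 0 ≤ Real.log (B * K) := Real.log_nonneg hBK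
  calc h x = h (m * (x / m)) := by rw [mul_div_cancel₀ _ hm0.ne']
    _ ≤ K * (B * K) ^ m := hpow _ ht m
    _ = K * Real.exp (Real.log (B * K) * m) := by
      rw [← Real.rpow_natCast, Real.rpow_def_of_pos (by linarith)]
    _ ≤ K * Real.exp (Real.log (B * K) * (|x| / δ + 2)) := by gcongr
    _ = _ := by
      rw [mul_assoc, ← Real.exp_add]
      ring_nf

end Submultiplicative

lemma lintegral_lt_top_of_le_exp {f : ℝ → ℝ} {C c : ℝ}
    (hf : ∀ x, f x ≤ C * Real.exp (c * |x|)) (hC : 0 ≤ C) {μ : Measure ℝ}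
    (hμ : ∀ t : ℝ, ∫⁻ x, ENNReal.ofReal (Real.exp (t * x)) ∂μ < ∞) :
    ∫⁻ x, ENNReal.ofReal (f x) ∂μ < ∞ := by
  have hle : ∀ x, ENNReal.ofReal (f x) ≤ ENNReal.ofReal C *
      (ENNReal.ofReal (Real.exp (c * x)) + ENNReal.ofReal (Real.exp (-c * x))) := by
    intro x
    rw [← ENNReal.ofReal_add (by positivity) (by positivity), ← ENNReal.ofReal_mul hC]
    refine ENNReal.ofReal_le_ofReal ((hf x).trans ?_)
    gcongr
    have h1 := Real.exp_pos (c * x)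
    have h2 := Real.exp_pos (-c * x)
    rcases abs_cases x with ⟨hx, _⟩ | ⟨hx, _⟩ <;> rw [hx]
    · linarith
    · rw [mul_neg, ← neg_mul]
      linarith
  refine (lintegral_mono hle).trans_lt ?_
  rw [lintegral_const_mul _ (by fun_prop), lintegral_add_left (by fun_prop)]
  exact ENNReal.mul_lt_top ENNReal.ofReal_lt_top (ENNReal.add_lt_top.2 ⟨hμ c, hμ (-c)⟩)

/-- The moment of a convolution is finite iff those of both factors are. -/
lemma lintegral_conv_lt_top_iff_of_submultiplicative {g : ℝ → ℝ≥0∞} {b : ℝ≥0∞}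
    (hg : Measurable g) (hgt : ∀ x, g x < ∞) (hb : b < ∞)
    (hsub : ∀ x y, g (x + y) ≤ b * g x * g y) (μ ν : Measure ℝ)
    [IsProbabilityMeasure μ] [IsProbabilityMeasure ν] :
    ∫⁻ x, g x ∂(μ ∗ ν) < ∞ ↔ ∫⁻ x, g x ∂μ < ∞ ∧ ∫⁻ x, g x ∂ν < ∞ := by
  have key : ∀ (α β : Measure ℝ) [IsProbabilityMeasure α] [IsProbabilityMeasure β],
      ∫⁻ x, g x ∂(α ∗ β) < ∞ → ∫⁻ x, g x ∂β < ∞ := by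
    intro α β _ _ hfin
    rw [Measure.lintegral_conv hg] at hfin
    have hae := ae_lt_top (by fun_prop) hfin.ne
    obtain ⟨x, hx⟩ := hae.exists
    calc ∫⁻ y, g y ∂β ≤ ∫⁻ y, b * g (-x) * g (x + y) ∂β :=
          lintegral_mono fun y => by simpa using hsub (-x) (x + y)
      _ = b * g (-x) * ∫⁻ y, g (x + y) ∂β := lintegral_const_mul _ (by fun_prop)
      _ < ∞ := ENNReal.mul_lt_top (ENNReal.mul_lt_top hb (hgt _)) hx
  refine ⟨fun hfin => ⟨key ν μ (by rwa [Measure.conv_comm]), key μ ν hfin⟩, fun ⟨hμ, hν⟩ => ?_⟩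
  rw [Measure.lintegral_conv hg]
  calc ∫⁻ x, ∫⁻ y, g (x + y) ∂ν ∂μ ≤ ∫⁻ x, ∫⁻ y, b * g x * g y ∂ν ∂μ :=
        lintegral_mono fun x => lintegral_mono fun y => hsub x y
    _ = b * (∫⁻ x, g x ∂μ) * ∫⁻ y, g y ∂ν := by
      simp_rw [lintegral_const_mul _ hg]
      rw [lintegral_mul_const _ (by fun_prop), lintegral_const_mul _ hg]
    _ < ∞ := ENNReal.mul_lt_top (ENNReal.mul_lt_top hb hμ) hν


section CompoundPoisson

/-- Iterated convolution power of a measure. -/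
def convPow (μ : Measure ℝ) : ℕ → Measure ℝ
  | 0 => Measure.dirac 0
  | n + 1 => μ ∗ convPow μ n

instance isFiniteMeasure_convPow (μ : Measure ℝ) [IsFiniteMeasure μ] (n : ℕ) :
    IsFiniteMeasure (convPow μ n) := by
  induction n with
  | zero => unfold convPow; infer_instance
  | succ n ih => unfold convPow; infer_instance

lemma charFun_convPow (μ : Measure ℝ) [IsFiniteMeasure μ] (n : ℕ) (t : ℝ) :
    charFun (convPow μ n) t = charFun μ t ^ n := by
  induction n with
  | zero => simp [convPow, charFun_dirac]
  | succ n ih => rw [convPow, charFun_conv, ih, pow_succ']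

lemma lintegral_convPow_of_map_add {f : ℝ → ℝ≥0∞} (hf : Measurable f) (h0 : f 0 = 1)
    (hadd : ∀ x y, f (x + y) = f x * f y) (μ : Measure ℝ) [IsFiniteMeasure μ] (n : ℕ) :
    ∫⁻ x, f x ∂(convPow μ n) = (∫⁻ x, f x ∂μ) ^ n := by
  induction n with
  | zero => simp [convPow, lintegral_dirac' _ hf, h0]
  | succ n ih =>
    rw [convPow, Measure.lintegral_conv hf]
    simp_rw [hadd, lintegral_const_mul _ hf, ih]
    rw [lintegral_mul_const _ hf, pow_succ']

lemma lintegral_convPow_le_of_submultiplicative {g : ℝ → ℝ≥0∞} {b : ℝ≥0∞} (hg : Measurable g)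
    (hsub : ∀ x y, g (x + y) ≤ b * g x * g y) (μ : Measure ℝ) [IsFiniteMeasure μ] (n : ℕ) :
    ∫⁻ x, g x ∂(convPow μ n) ≤ g 0 * (b * ∫⁻ x, g x ∂μ) ^ n := by
  induction n with
  | zero => simp [convPow, lintegral_dirac' _ hg]
  | succ n ih =>
    rw [convPow, Measure.lintegral_conv hg]
    calc ∫⁻ x, ∫⁻ y, g (x + y) ∂(convPow μ n) ∂μ
        ≤ ∫⁻ x, ∫⁻ y, b * g x * g y ∂(convPow μ n) ∂μ :=
          lintegral_mono fun x => lintegral_mono fun y => hsub x y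
      _ = (b * ∫⁻ x, g x ∂μ) * ∫⁻ y, g y ∂(convPow μ n) := by
        simp_rw [lintegral_const_mul _ hg]
        rw [lintegral_mul_const _ (by fun_prop), lintegral_const_mul _ hg]
      _ ≤ (b * ∫⁻ x, g x ∂μ) * (g 0 * (b * ∫⁻ x, g x ∂μ) ^ n) := by gcongr
      _ = _ := by ring

/-- The compound Poisson distribution with finite jump measure `μ`. -/
def compoundPoisson (μ : Measure ℝ) : Measure ℝ :=
  Measure.sum fun n : ℕ =>
    ENNReal.ofReal (Real.exp (-μ.real Set.univ) / n.factorial) • convPow μ n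

variable {μ : Measure ℝ}

lemma lintegral_compoundPoisson (f : ℝ → ℝ≥0∞) :
    ∫⁻ x, f x ∂(compoundPoisson μ) = ∑' n : ℕ,
      ENNReal.ofReal (Real.exp (-μ.real Set.univ) / n.factorial) *
        ∫⁻ x, f x ∂(convPow μ n) := by
  simp [compoundPoisson, lintegral_sum_measure, lintegral_smul_measure]

lemma tsum_ofReal_div_factorial_mul_pow (s : ℝ) {r : ℝ} (hr : 0 ≤ r) :
    ∑' n : ℕ, ENNReal.ofReal (Real.exp s / n.factorial) * ENNReal.ofReal r ^ n =
      ENNReal.ofReal (Real.exp (s + r)) := by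
  have hs : HasSum (fun n : ℕ => Real.exp s / n.factorial * r ^ n) (Real.exp (s + r)) := by
    rw [Real.exp_add, Real.exp_eq_exp_ℝ]
    convert! (NormedSpace.expSeries_div_hasSum_exp r).mul_left (NormedSpace.exp s) using 2
    ring
  rw [← hs.tsum_eq, ENNReal.ofReal_tsum_of_nonneg (fun n => by positivity) hs.summable]
  refine tsum_congr fun n => ?_
  rw [ENNReal.ofReal_mul (by positivity), ENNReal.ofReal_pow hr]

variable [IsFiniteMeasure μ]

lemma lintegral_compoundPoisson_of_map_add {f : ℝ → ℝ≥0∞} (hf : Measurable f) (h0 : f 0 = 1)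
    (hadd : ∀ x y, f (x + y) = f x * f y) {r : ℝ} (hr : 0 ≤ r)
    (hfr : ∫⁻ x, f x ∂μ = ENNReal.ofReal r) :
    ∫⁻ x, f x ∂(compoundPoisson μ) = ENNReal.ofReal (Real.exp (-μ.real Set.univ + r)) := by
  simp_rw [lintegral_compoundPoisson, lintegral_convPow_of_map_add hf h0 hadd, hfr]
  exact tsum_ofReal_div_factorial_mul_pow _ hr

instance isProbabilityMeasure_compoundPoisson : IsProbabilityMeasure (compoundPoisson μ) := by
  constructor
  rw [← lintegral_one]
  have := lintegral_compoundPoisson_of_map_add (μ := μ) (f := fun _ => 1) measurable_const rfl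
    (by simp) (r := μ.real Set.univ) (by positivity) (by simp)
  simpa using this

lemma charFun_compoundPoisson (t : ℝ) :
    charFun (compoundPoisson μ) t = cexp (charFun μ t - μ.real Set.univ) := by
  have hint : Integrable (fun x : ℝ => cexp (t * x * I)) (compoundPoisson μ) := by
    refine Integrable.of_bound (by fun_prop) 1 (.of_forall fun x => ?_)
    rw [← ofReal_mul, norm_exp_ofReal_mul_I]
  have hs := hasSum_integral_measure (μ := fun n : ℕ =>
    ENNReal.ofReal (Real.exp (-μ.real Set.univ) / n.factorial) • convPow μ n) hint
  rw [charFun_apply_real]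
  refine hs.unique ?_
  have he := (NormedSpace.expSeries_div_hasSum_exp (charFun μ t)).mul_left
    (cexp (-μ.real Set.univ))
  rw [← exp_eq_exp_ℂ, ← Complex.exp_add, neg_add_eq_sub] at he
  convert! he using 2 with n
  rw [integral_smul_measure, ← charFun_apply_real, charFun_convPow,
    ENNReal.toReal_ofReal (by positivity), real_smul]
  push_cast
  ring

/-- The moment of a compound Poisson distribution is finite iff that of its jump measure is. -/
lemma lintegral_compoundPoisson_lt_top_iff {g : ℝ → ℝ≥0∞} {b : ℝ≥0∞}
    (hg : Measurable g) (hgt : ∀ x, g x < ∞) (hb : b < ∞)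
    (hsub : ∀ x y, g (x + y) ≤ b * g x * g y) :
    ∫⁻ x, g x ∂(compoundPoisson μ) < ∞ ↔ ∫⁻ x, g x ∂μ < ∞ := by
  refine ⟨fun hfin => ?_, fun hfin => ?_⟩
  · have hone : convPow μ 1 = μ := by simp [convPow]
    rw [lintegral_compoundPoisson] at hfin
    have h1 := (ENNReal.le_tsum 1).trans_lt hfin
    rw [hone] at h1
    refine ENNReal.lt_top_of_mul_ne_top_right h1.ne ?_
    rw [Ne, ENNReal.ofReal_eq_zero, not_le]
    positivity
  · obtain ⟨r, hr⟩ : ∃ r : ℝ, b * ∫⁻ x, g x ∂μ = ENNReal.ofReal r :=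
      ⟨_, (ENNReal.ofReal_toReal (ENNReal.mul_lt_top hb hfin).ne).symm⟩
    rw [lintegral_compoundPoisson]
    calc _ ≤ ∑' n : ℕ, g 0 *
          (ENNReal.ofReal (Real.exp (-μ.real Set.univ) / n.factorial) *
            ENNReal.ofReal (max r 0) ^ n) := by
          refine ENNReal.tsum_le_tsum fun n => ?_
          have hle := lintegral_convPow_le_of_submultiplicative hg hsub μ n
          rw [hr] at hle
          have hmax : ENNReal.ofReal (max r 0) = ENNReal.ofReal r := by simp [ENNReal.ofReal_max]
          rw [hmax, mul_left_comm]
          gcongr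
      _ = g 0 * ENNReal.ofReal (Real.exp (-μ.real Set.univ + max r 0)) := by
          rw [ENNReal.tsum_mul_left, tsum_ofReal_div_factorial_mul_pow _ (le_max_right _ _)]
      _ < ∞ := ENNReal.mul_lt_top (hgt 0) ENNReal.ofReal_lt_top

end CompoundPoisson

section SmallJumps

lemma norm_exp_mul_sub_one_sub_le (w : ℂ) {x : ℝ} (hx : |x| ≤ 1) :
    ‖cexp (w * x) - 1 - w * x‖ ≤ ‖w‖ ^ 2 * Real.exp ‖w‖ * x ^ 2 := by
  have h1 := norm_exp_sub_sum_le_norm_mul_exp (w * x) 2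
  have h2 : ‖w * x‖ ≤ ‖w‖ := by
    rw [norm_mul, norm_real, Real.norm_eq_abs]
    exact mul_le_of_le_one_right (norm_nonneg _) hx
  simp only [Finset.sum_range_succ, Finset.sum_range_zero, pow_zero, Nat.factorial_zero,
    Nat.cast_one, div_one, zero_add, pow_one, Nat.factorial_one, ← sub_sub] at h1
  calc _ ≤ ‖w * x‖ ^ 2 * Real.exp ‖w * x‖ := h1
    _ ≤ ‖w * x‖ ^ 2 * Real.exp ‖w‖ := by gcongr
    _ = _ := by
      rw [norm_mul, norm_real, Real.norm_eq_abs, mul_pow, sq_abs]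
      ring

variable {ν : Measure ℝ}

lemma integrable_exp_mul_sub_one_sub (hν : Integrable (fun x : ℝ => x ^ 2) ν)
    (hν1 : ∀ᵐ x ∂ν, |x| ≤ 1) (w : ℂ) :
    Integrable (fun x : ℝ => cexp (w * x) - 1 - w * x) ν := by
  refine (hν.const_mul (‖w‖ ^ 2 * Real.exp ‖w‖)).mono' (by fun_prop) ?_
  filter_upwards [hν1] with x hx using norm_exp_mul_sub_one_sub_le w hx

lemma norm_integral_exp_mul_sub_one_sub_le (hν : Integrable (fun x : ℝ => x ^ 2) ν)
    (hν1 : ∀ᵐ x ∂ν, |x| ≤ 1) (w : ℂ) :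
    ‖∫ x : ℝ, cexp (w * x) - 1 - w * x ∂ν‖ ≤
      ‖w‖ ^ 2 * Real.exp ‖w‖ * ∫ x, x ^ 2 ∂ν := by
  rw [← integral_const_mul]
  refine norm_integral_le_of_norm_le (hν.const_mul _) ?_
  filter_upwards [hν1] with x hx using norm_exp_mul_sub_one_sub_le w hx

/-- The compound Poisson distribution with jump measure `ν`, centred at its mean. -/
def centeredCompoundPoisson (ν : Measure ℝ) : Measure ℝ :=
  compoundPoisson ν ∗ Measure.dirac (-∫ x, x ∂ν)

instance [IsFiniteMeasure ν] : IsProbabilityMeasure (centeredCompoundPoisson ν) := by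
  unfold centeredCompoundPoisson
  infer_instance

lemma integrable_exp_mul_of_abs_le_one [IsFiniteMeasure ν] (hν1 : ∀ᵐ x ∂ν, |x| ≤ 1) (w : ℂ) :
    Integrable (fun x : ℝ => cexp (w * x)) ν := by
  refine Integrable.of_bound (by fun_prop) (Real.exp ‖w‖) ?_
  filter_upwards [hν1] with x hx
  refine (norm_exp_le_exp_norm _).trans (Real.exp_le_exp.2 ?_)
  rw [norm_mul, norm_real, Real.norm_eq_abs]
  exact mul_le_of_le_one_right (norm_nonneg _) hx

lemma integrable_id_of_abs_le_one [IsFiniteMeasure ν] (hν1 : ∀ᵐ x ∂ν, |x| ≤ 1) :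
    Integrable (fun x : ℝ => x) ν :=
  Integrable.of_bound (by fun_prop) 1 hν1

lemma integral_exp_mul_sub_one_sub [IsFiniteMeasure ν] (hν1 : ∀ᵐ x ∂ν, |x| ≤ 1) (w : ℂ) :
    ∫ x : ℝ, cexp (w * x) - 1 - w * x ∂ν =
      ∫ x : ℝ, cexp (w * x) ∂ν - ν.real Set.univ - w * (∫ x : ℝ, x ∂ν : ℝ) := by
  have h1 := integrable_exp_mul_of_abs_le_one hν1 w
  have h2 : Integrable (fun x : ℝ => (x : ℂ)) ν := (integrable_id_of_abs_le_one hν1).ofReal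
  have h3 : Integrable (fun x : ℝ => cexp (w * x) - 1) ν := h1.sub (integrable_const 1)
  rw [integral_sub h3 (h2.const_mul w), integral_sub h1 (integrable_const 1),
    integral_const_mul, integral_complex_ofReal]
  simp

lemma charFun_centeredCompoundPoisson [IsFiniteMeasure ν] (hν1 : ∀ᵐ x ∂ν, |x| ≤ 1) (t : ℝ) :
    charFun (centeredCompoundPoisson ν) t =
      cexp (∫ x : ℝ, cexp (I * t * x) - 1 - I * t * x ∂ν) := by
  have hcomm : ∀ x : ℝ, (t * x * I : ℂ) = I * t * x := fun x => by ring
  rw [centeredCompoundPoisson, charFun_conv, charFun_compoundPoisson, charFun_dirac,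
    ← Complex.exp_add, integral_exp_mul_sub_one_sub hν1, charFun_apply_real]
  simp_rw [hcomm]
  congr 1
  simp
  ring

lemma lintegral_exp_mul_centeredCompoundPoisson_le [IsFiniteMeasure ν]
    (hν : Integrable (fun x : ℝ => x ^ 2) ν) (hν1 : ∀ᵐ x ∂ν, |x| ≤ 1) (s : ℝ) :
    ∫⁻ x, ENNReal.ofReal (Real.exp (s * x)) ∂(centeredCompoundPoisson ν) ≤
      ENNReal.ofReal (Real.exp (s ^ 2 * Real.exp |s| * ∫ x, x ^ 2 ∂ν)) := by
  have hexp : Integrable (fun x : ℝ => Real.exp (s * x)) ν := by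
    have := (integrable_exp_mul_of_abs_le_one hν1 s).re
    refine this.congr (.of_forall fun x => ?_)
    simp [← ofReal_mul, exp_ofReal_re]
  have hcp := lintegral_compoundPoisson_of_map_add (μ := ν)
    (f := fun x => ENNReal.ofReal (Real.exp (s * x))) (by fun_prop) (by simp)
    (fun x y => by rw [← ENNReal.ofReal_mul (by positivity), ← Real.exp_add, mul_add])
    (integral_nonneg fun x => (Real.exp_pos (s * x)).le)
    (ofReal_integral_eq_lintegral_ofReal hexp (.of_forall fun x => (Real.exp_pos _).le)).symm
  rw [centeredCompoundPoisson, Measure.lintegral_conv (by fun_prop)]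
  simp_rw [lintegral_dirac, mul_add, Real.exp_add, ENNReal.ofReal_mul (Real.exp_pos _).le]
  rw [lintegral_mul_const _ (by fun_prop), hcp, ← ENNReal.ofReal_mul (by positivity),
    ← Real.exp_add]
  refine ENNReal.ofReal_le_ofReal (Real.exp_le_exp.2 ?_)
  have hle := norm_integral_exp_mul_sub_one_sub_le hν hν1 s
  rw [integral_exp_mul_sub_one_sub hν1] at hle
  have hre := (re_le_norm _).trans hle
  have hI : ∫ x : ℝ, cexp (s * x) ∂ν = (∫ x : ℝ, Real.exp (s * x) ∂ν : ℝ) := by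
    rw [← integral_complex_ofReal]
    simp
  rw [hI, ← ofReal_mul, ← ofReal_sub, ← ofReal_sub, ofReal_re, norm_real, Real.norm_eq_abs,
    sq_abs] at hre
  linarith

lemma continuousAt_integral_exp_mul_sub_one_sub (hν : Integrable (fun x : ℝ => x ^ 2) ν)
    (hν1 : ∀ᵐ x ∂ν, |x| ≤ 1) :
    ContinuousAt (fun t : ℝ => ∫ x : ℝ, cexp (I * t * x) - 1 - I * t * x ∂ν) 0 := by
  have hlim : Tendsto (fun t : ℝ => |t| ^ 2 * Real.exp |t| * ∫ x, x ^ 2 ∂ν) (𝓝 0) (𝓝 0) := by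
    have hc : Continuous fun t : ℝ => |t| ^ 2 * Real.exp |t| * ∫ x, x ^ 2 ∂ν := by fun_prop
    simpa using hc.tendsto 0
  rw [ContinuousAt]
  simp only [ofReal_zero, mul_zero, zero_mul, Complex.exp_zero, sub_self, integral_zero]
  refine squeeze_zero_norm (fun t => ?_) hlim
  simpa using norm_integral_exp_mul_sub_one_sub_le hν hν1 (I * t)

/-- Weak limits of laws with convergent characteristic functions and bounded exponential moments
have exponential moments. -/
lemma exists_isProbabilityMeasure_of_tendsto_charFun {ρ : ℕ → Measure ℝ}
    [∀ n, IsProbabilityMeasure (ρ n)] {f : ℝ → ℂ} (hf : ContinuousAt f 0)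
    (hρ : ∀ t, Tendsto (fun n => charFun (ρ n) t) atTop (𝓝 (f t)))
    (hexp : ∀ s : ℝ, ∃ M : ℝ≥0∞, M < ∞ ∧
      ∀ n, ∫⁻ x, ENNReal.ofReal (Real.exp (s * x)) ∂(ρ n) ≤ M) :
    ∃ η : Measure ℝ, IsProbabilityMeasure η ∧ (∀ t, charFun η t = f t) ∧
      ∀ s : ℝ, ∫⁻ x, ENNReal.ofReal (Real.exp (s * x)) ∂η < ∞ := by
  let P : ℕ → ProbabilityMeasure ℝ := fun n => ⟨ρ n, inferInstance⟩
  have htight := isTightMeasureSet_of_tendsto_charFun hf hρ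
  have hcomp : IsCompact (closure (Set.range P)) := by
    refine isCompact_closure_of_isTightMeasureSet (htight.subset ?_)
    rintro _ ⟨_, ⟨n, rfl⟩, rfl⟩
    exact ⟨n, rfl⟩
  obtain ⟨η, -, φ, hφ, hη⟩ := hcomp.tendsto_subseq fun n => subset_closure (Set.mem_range_self n)
  refine ⟨η, inferInstance, fun t => ?_, fun s => ?_⟩
  · exact tendsto_nhds_unique (ProbabilityMeasure.tendsto_iff_tendsto_charFun.1 hη t)
      ((hρ t).comp hφ.tendsto_atTop)
  · obtain ⟨M, hM, hle⟩ := hexp s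
    refine (lintegral_le_liminf_lintegral_of_forall_isOpen_measure_le_liminf_measure
      (μs := fun n => ρ (φ n)) (by fun_prop) (fun x => (Real.exp_pos _).le) fun G hG =>
        ProbabilityMeasure.le_liminf_measure_open_of_tendsto hη hG).trans_lt ?_
    exact (liminf_le_of_le (by isBoundedDefault)
      fun b hb => (hb.exists.choose_spec.trans (hle _))).trans_lt hM

/-- Existence and exponential integrability of the infinitely divisible law with Lévy measure `ν`
supported in `[-1, 1]`. -/
lemma exists_charFun_eq_exp_of_abs_le_one (hν : Integrable (fun x : ℝ => x ^ 2) ν)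
    (hν1 : ∀ᵐ x ∂ν, |x| ≤ 1) (hν0 : ν {0} = 0) :
    ∃ η : Measure ℝ, IsProbabilityMeasure η ∧
      (∀ t : ℝ, charFun η t = cexp (∫ x : ℝ, cexp (I * t * x) - 1 - I * t * x ∂ν)) ∧
      ∀ s : ℝ, ∫⁻ x, ENNReal.ofReal (Real.exp (s * x)) ∂η < ∞ := by
  let S : ℕ → Set ℝ := fun n => {x | 1 / ((n : ℝ) + 1) ≤ |x|}
  have hS : ∀ n, MeasurableSet (S n) := fun n => measurableSet_le measurable_const (by fun_prop)
  have hSmono : Monotone S := fun m n hmn x hx =>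
    (Nat.one_div_le_one_div hmn).trans (show _ ≤ |x| from hx)
  have hSU : ν.restrict (⋃ n, S n) = ν := by
    refine Measure.restrict_eq_self_of_ae_mem ?_
    filter_upwards [measure_eq_zero_iff_ae_notMem.1 hν0] with x hx
    obtain ⟨n, hn⟩ := exists_nat_one_div_lt (abs_pos.2 hx)
    exact Set.mem_iUnion.2 ⟨n, hn.le⟩
  have hSfin : ∀ n, IsFiniteMeasure (ν.restrict (S n)) := by
    intro n
    refine ⟨?_⟩
    rw [Measure.restrict_apply_univ]
    refine (measure_mono fun x hx => ?_).trans_lt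
      (hν.measure_norm_ge_lt_top (ε := (1 / ((n : ℝ) + 1)) ^ 2) (by positivity))
    have hx' : 1 / ((n : ℝ) + 1) ≤ |x| := hx
    simp only [Set.mem_ofPred_eq, norm_pow, Real.norm_eq_abs]
    gcongr
  have hS1 : ∀ n, ∀ᵐ x ∂(ν.restrict (S n)), |x| ≤ 1 := fun n => ae_restrict_of_ae hν1
  refine exists_isProbabilityMeasure_of_tendsto_charFun
    (ρ := fun n => centeredCompoundPoisson (ν.restrict (S n)))
    (continuousAt_integral_exp_mul_sub_one_sub hν hν1).cexp (fun t => ?_) fun s =>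
      ⟨_, ENNReal.ofReal_lt_top, fun n =>
        (lintegral_exp_mul_centeredCompoundPoisson_le hν.restrict (hS1 n) s).trans
          (ENNReal.ofReal_le_ofReal (Real.exp_le_exp.2 (mul_le_mul_of_nonneg_left
            (setIntegral_le_integral hν (.of_forall fun x => sq_nonneg x)) (by positivity))))⟩
  simp_rw [charFun_centeredCompoundPoisson (hS1 _)]
  refine (Complex.continuous_exp.tendsto _).comp ?_
  have hlim := tendsto_setIntegral_of_monotone hS hSmono
    (integrable_exp_mul_sub_one_sub hν hν1 (I * t)).integrableOn
  rwa [hSU] at hlim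

end SmallJumps

section LevyKhintchine

lemma charFn_eq_charFun (μ : Measure ℝ) (z : ℝ) : charFn μ z = charFun μ z := by
  rw [charFn, charFun_apply_real]
  congr with x
  ring_nf

/-- A measure integrating `min 1 (x ^ 2)` and without atom at the origin is the Lévy measure of an
infinitely divisible law without Gaussian part; a submultiplicative moment of this law is finite
iff that of the Lévy measure outside of `[-1, 1]` is. -/
lemma exists_charFun_eq_exp_lkInt {ν : Measure ℝ} (hν0 : ν {0} = 0)
    (hν : ∫⁻ x, ENNReal.ofReal (min 1 (x ^ 2)) ∂ν < ∞) :
    ∃ η : Measure ℝ, IsProbabilityMeasure η ∧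
      (∀ t : ℝ, charFun η t = cexp (lkInt (fun x => if |x| ≤ 1 then x else 0) ν t)) ∧
      ∀ (h : ℝ → ℝ) (B : ℝ), Measurable h → (∀ x, 0 ≤ h x) → 0 < B →
        (∀ x y : ℝ, h (x + y) ≤ B * h x * h y) →
        (∫⁻ x, ENNReal.ofReal (h x) ∂η < ∞ ↔
          ∫⁻ x in {x : ℝ | 1 < |x|}, ENNReal.ofReal (h x) ∂ν < ∞) := by
  let T : Set ℝ := {x | 1 < |x|}
  have hT : MeasurableSet T := measurableSet_lt measurable_const (by fun_prop)
  have hTc : ∀ x ∈ Tᶜ, |x| ≤ 1 := fun x hx => not_lt.1 hx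
  have hfin : IsFiniteMeasure (ν.restrict T) := by
    refine ⟨lt_of_le_of_lt ?_ hν⟩
    rw [← lintegral_one]
    refine (setLIntegral_mono' hT fun x hx => ?_).trans (setLIntegral_le_lintegral T _)
    have hx1 : 1 < |x| := hx
    rw [min_eq_left (by rw [← sq_abs]; nlinarith), ENNReal.ofReal_one]
  have hsq : Integrable (fun x : ℝ => x ^ 2) (ν.restrict Tᶜ) := by
    refine ⟨by fun_prop, ?_⟩
    rw [hasFiniteIntegral_iff_ofReal (.of_forall fun x => sq_nonneg x)]
    refine lt_of_le_of_lt ?_ hν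
    refine (setLIntegral_mono' hT.compl fun x hx => ?_).trans (setLIntegral_le_lintegral _ _)
    have hx1 := hTc x hx
    have hx0 := abs_nonneg x
    rw [min_eq_right (by rw [← sq_abs]; nlinarith)]
  have hν1 : ∀ᵐ x ∂(ν.restrict Tᶜ), |x| ≤ 1 :=
    (ae_restrict_mem hT.compl).mono hTc
  obtain ⟨ρ, hρ, hρchar, hρexp⟩ := exists_charFun_eq_exp_of_abs_le_one hsq hν1
    (le_antisymm ((Measure.restrict_apply_le _ _).trans hν0.le) bot_le)
  refine ⟨compoundPoisson (ν.restrict T) ∗ ρ, inferInstance, fun t => ?_, ?_⟩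
  · have hbig : Integrable (fun x : ℝ => cexp (I * t * x)) (ν.restrict T) := by
      refine Integrable.of_bound (by fun_prop) 1 (.of_forall fun x => ?_)
      rw [mul_assoc, ← ofReal_mul, norm_exp_I_mul_ofReal]
    have hT' : Set.EqOn (fun x : ℝ => cexp (I * t * x) - 1 -
        I * t * ((if |x| ≤ 1 then x else 0 : ℝ) : ℂ)) (fun x => cexp (I * t * x) - 1) T := by
      intro x hx
      simp [not_le.2 (show 1 < |x| from hx)]
    have hTc' : Set.EqOn (fun x : ℝ => cexp (I * t * x) - 1 -
        I * t * ((if |x| ≤ 1 then x else 0 : ℝ) : ℂ))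
        (fun x => cexp (I * t * x) - 1 - I * t * x) Tᶜ := by
      intro x hx
      simp [hTc x hx]
    have hint := ((integrableOn_congr_fun hT' hT).2 (hbig.sub (integrable_const 1))).union
      ((integrableOn_congr_fun hTc' hT.compl).2 (integrable_exp_mul_sub_one_sub hsq hν1 (I * t)))
    rw [Set.union_compl_self, integrableOn_univ] at hint
    rw [lkInt, ← integral_add_compl hT hint, setIntegral_congr_fun hT hT',
      setIntegral_congr_fun hT.compl hTc', charFun_conv, charFun_compoundPoisson, hρchar,
      Complex.exp_add, integral_sub hbig (integrable_const 1), ← charFn_eq_charFun, charFn]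
    simp
  · intro h B hmeas hnn hB hsub
    obtain ⟨C, c, hC, hle⟩ := exists_le_exp_of_submultiplicative hmeas hnn hB hsub
    have hg : Measurable fun x => ENNReal.ofReal (h x) := by fun_prop
    have hgsub : ∀ x y, ENNReal.ofReal (h (x + y)) ≤
        ENNReal.ofReal B * ENNReal.ofReal (h x) * ENNReal.ofReal (h y) := fun x y => by
      rw [← ENNReal.ofReal_mul hB.le, ← ENNReal.ofReal_mul (mul_nonneg hB.le (hnn x))]
      exact ENNReal.ofReal_le_ofReal (hsub x y)
    rw [lintegral_conv_lt_top_iff_of_submultiplicative hg (fun _ => ENNReal.ofReal_lt_top)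
      ENNReal.ofReal_lt_top hgsub, lintegral_compoundPoisson_lt_top_iff hg
      (fun _ => ENNReal.ofReal_lt_top) ENNReal.ofReal_lt_top hgsub]
    exact and_iff_left (lintegral_lt_top_of_le_exp hle hC hρexp)

end LevyKhintchine

/-- moment criterion: ∫h dμ < ∞ and ∫_{|x|>1} h dν⁻ < ∞ iff
∫_{|x|>1} h dν⁺ < ∞, for h submultiplicative. -/
theorem stmt14 (μ : Measure ℝ) [IsProbabilityMeasure μ] (a γ : ℝ) (νp νm : Measure ℝ)
    (htrip : HasTriplet (fun x => if |x| ≤ 1 then x else 0) μ a νp νm γ)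
    (h : ℝ → ℝ) (hmeas : Measurable h) (hnn : ∀ x, 0 ≤ h x)
    (B : ℝ) (hB : 0 < B) (hsub : ∀ x y : ℝ, h (x + y) ≤ B * h x * h y) :
    (Integrable h μ ∧ (∫⁻ x in {x : ℝ | 1 < |x|}, ENNReal.ofReal (h x) ∂νm) < ⊤) ↔
      (∫⁻ x in {x : ℝ | 1 < |x|}, ENNReal.ofReal (h x) ∂νp) < ⊤ := by
  obtain ⟨-, hp0, hm0, hfin, hchar⟩ := htrip
  rw [lintegral_add_measure, ENNReal.add_lt_top] at hfin
  obtain ⟨P, _, hPchar, hPmom⟩ := exists_charFun_eq_exp_lkInt hp0 hfin.1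
  obtain ⟨M, _, hMchar, hMmom⟩ := exists_charFun_eq_exp_lkInt hm0 hfin.2
  let G₁ := ProbabilityTheory.gaussianReal 0 (-a).toNNReal
  let G₂ := ProbabilityTheory.gaussianReal γ a.toNNReal
  have heq : μ ∗ G₁ ∗ M = G₂ ∗ P := by
    refine Measure.ext_of_charFun (funext fun z => ?_)
    have ha : ((a.toNNReal : ℝ) : ℂ) - (((-a).toNNReal : ℝ) : ℂ) = a := by
      rw [← ofReal_sub, Real.coe_toNNReal', Real.coe_toNNReal', max_zero_sub_max_neg_zero_eq_self]
    simp only [charFun_conv, ← charFn_eq_charFun μ, hchar, hPchar, hMchar, G₁, G₂,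
      ProbabilityTheory.charFun_gaussianReal, ← Complex.exp_add]
    congr 1
    rw [← ha]
    push_cast
    ring
  obtain ⟨C, c, hC, hle⟩ := exists_le_exp_of_submultiplicative hmeas hnn hB hsub
  have hgauss : ∀ m v, ∫⁻ x, ENNReal.ofReal (h x) ∂(ProbabilityTheory.gaussianReal m v) < ⊤ :=
    fun m v => lintegral_lt_top_of_le_exp hle hC fun t =>
      (hasFiniteIntegral_iff_ofReal (.of_forall fun x => (Real.exp_pos _).le)).1
        (ProbabilityTheory.integrable_exp_mul_gaussianReal t).2
  have hconv := lintegral_conv_lt_top_iff_of_submultiplicative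
    (g := fun x => ENNReal.ofReal (h x)) (b := ENNReal.ofReal B) (by fun_prop)
    (fun _ => ENNReal.ofReal_lt_top) ENNReal.ofReal_lt_top fun x y => by
      rw [← ENNReal.ofReal_mul hB.le, ← ENNReal.ofReal_mul (mul_nonneg hB.le (hnn x))]
      exact ENNReal.ofReal_le_ofReal (hsub x y)
  have hiff := hconv μ (G₁ ∗ M)
  rw [heq, hconv, hconv, and_iff_right (hgauss _ _), and_iff_right (hgauss _ _)] at hiff
  have hint : Integrable h μ ↔ ∫⁻ x, ENNReal.ofReal (h x) ∂μ < ⊤ := by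
    rw [Integrable, and_iff_right hmeas.aestronglyMeasurable,
      hasFiniteIntegral_iff_ofReal (.of_forall hnn)]
  rw [hint, ← hMmom h B hmeas hnn hB hsub, ← hPmom h B hmeas hnn hB hsub, hiff]
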